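/- Let X be an mm-space, T an ℝ-tree, and p ≥ 1. Then ObsL^pVar_T(X) ≤ 2·(2^{1/p}(1 + 2·2^{1/p}) + 1)·ObsL^pVar_ℝ(X) (where both sides may take the value +∞). Consequently, for a sequence {X_n} of mm-spaces, ObsL^pVar_ℝ(X_n) → 0 as n → ∞ if and only if sup{ ObsL^pVar_T(X_n) : T is an ℝ-tree } → 0 as n → ∞. -/

import Mathlib

open MeasureTheory ENNReal

/-- The distance between two subsets of an (extended) metric space. -/
noncomputable def setSep {α : Type*} [PseudoEMetricSpace α] (A B : Set α) : ℝ≥0∞ :=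
  ⨅ x ∈ A, EMetric.infEdist x B

/-- The separation distance `Sep(μ; κ₁, κ₂)`: the supremum of the distances `d(A,B)` over
Borel sets `A`, `B` with `μ A ≥ κ₁` and `μ B ≥ κ₂`. -/
noncomputable def sep {α : Type*} [PseudoEMetricSpace α] [MeasurableSpace α]
    (μ : Measure α) (κ₁ κ₂ : ℝ≥0∞) : ℝ≥0∞ :=
  ⨆ (A : Set α) (B : Set α) (_ : MeasurableSet A) (_ : MeasurableSet B)
    (_ : κ₁ ≤ μ A) (_ : κ₂ ≤ μ B), setSep A B

/-- The partial diameter `diam(ν, a)`: the infimum of diameters of Borel sets of measure `≥ a`. -/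
noncomputable def partialDiam {α : Type*} [PseudoEMetricSpace α] [MeasurableSpace α]
    (ν : Measure α) (a : ℝ≥0∞) : ℝ≥0∞ :=
  ⨅ (s : Set α) (_ : MeasurableSet s) (_ : a ≤ ν s), EMetric.diam s

/-- The observable diameter `ObsDiam_Y(X; -κ)`. -/
noncomputable def obsDiam (Y : Type*) [MetricSpace Y] [MeasurableSpace Y]
    {X : Type*} [MetricSpace X] [MeasurableSpace X] (μ : Measure X) (κ : ℝ≥0∞) : ℝ≥0∞ :=
  ⨆ (f : X → Y) (_ : LipschitzWith 1 f), partialDiam (Measure.map f μ) (μ Set.univ - κ)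

/-- `V_p(ν) = (∬ d(x,y)^p dν dν)^{1/p}`. -/
noncomputable def varP {α : Type*} [PseudoEMetricSpace α] [MeasurableSpace α]
    (ν : Measure α) (p : ℝ) : ℝ≥0∞ :=
  (∫⁻ x, ∫⁻ y, edist x y ^ p ∂ν ∂ν) ^ (1 / p)

/-- The observable `L^p`-variation `ObsL^pVar_Y(X)`. -/
noncomputable def obsVar (Y : Type*) [MetricSpace Y] [MeasurableSpace Y]
    {X : Type*} [MetricSpace X] [MeasurableSpace X] (μ : Measure X) (p : ℝ) : ℝ≥0∞ :=
  ⨆ (f : X → Y) (_ : LipschitzWith 1 f), varP (Measure.map f μ) p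

/-- The central radius: the infimum of `ρ > 0` such that the closed ball of radius `ρ`
around `c` has measure at least `a`. -/
noncomputable def cRad {α : Type*} [PseudoEMetricSpace α] [MeasurableSpace α]
    (ν : Measure α) (c : α) (a : ℝ≥0∞) : ℝ≥0∞ :=
  sInf {ρ : ℝ≥0∞ | 0 < ρ ∧ a ≤ ν (EMetric.closedBall c ρ)}

/-- `z₀` is the center of mass of `ν`: for every `z`, `z₀` is the unique minimizer of
`x ↦ ∫ (d(x,y)² - d(z,y)²) dν(y)`. -/
def IsCenterOfMass {α : Type*} [MetricSpace α] [MeasurableSpace α]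
    (ν : Measure α) (z₀ : α) : Prop :=
  ∀ z x : α, x ≠ z₀ →
    (∫ y, (dist z₀ y ^ 2 - dist z y ^ 2) ∂ν) < ∫ y, (dist x y ^ 2 - dist z y ^ 2) ∂ν

/-- `ν` has a finite first moment: `∫ d(x,y) dν(y) < ∞` for some `x`. -/
def FiniteFirstMoment {α : Type*} [MetricSpace α] [MeasurableSpace α] (ν : Measure α) : Prop :=
  ∃ x : α, (∫⁻ y, edist x y ∂ν) < ⊤

/-- `ν` has separable support. -/
def HasSeparableSupport {α : Type*} [MetricSpace α] [MeasurableSpace α] (ν : Measure α) : Prop :=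
  ∃ s : Set α, TopologicalSpace.IsSeparable s ∧ ν sᶜ = 0

/-- `γ` (restricted to `[0, d(z,w)]`) is a geodesic from `z` to `w`, i.e. an isometric
embedding of the interval `[0, d(z,w)]` sending the endpoints to `z` and `w`. -/
def IsGeodesic {T : Type*} [MetricSpace T] (z w : T) (γ : ℝ → T) : Prop :=
  γ 0 = z ∧ γ (dist z w) = w ∧
    ∀ s ∈ Set.Icc (0 : ℝ) (dist z w), ∀ t ∈ Set.Icc (0 : ℝ) (dist z w),
      dist (γ s) (γ t) = |s - t|

/-- An `ℝ`-tree: a complete geodesic metric space which is `0`-hyperbolic. -/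
def IsRTree (T : Type*) [MetricSpace T] : Prop :=
  CompleteSpace T ∧ (∀ z w : T, ∃ γ : ℝ → T, IsGeodesic z w γ) ∧
    ∀ x y z w : T, dist x y + dist z w ≤ max (dist x z + dist y w) (dist x w + dist y z)

/-- A set is (geodesically) convex if every geodesic joining two of its points stays in it. -/
def GeodConvex {T : Type*} [MetricSpace T] (s : Set T) : Prop :=
  ∀ z ∈ s, ∀ w ∈ s, ∀ γ : ℝ → T, IsGeodesic z w γ →
    γ '' Set.Icc (0 : ℝ) (dist z w) ⊆ s

/-- `z` is a median of `ν`: there are closed convex `T'`, `T''` covering the space with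
`T' ∩ T'' = {z}` and both of measure at least `ν(univ)/3`. -/
def IsMedian {T : Type*} [MetricSpace T] [MeasurableSpace T] (ν : Measure T) (z : T) : Prop :=
  ∃ T' T'' : Set T, IsClosed T' ∧ IsClosed T'' ∧ GeodConvex T' ∧ GeodConvex T'' ∧
    T' ∪ T'' = Set.univ ∧ T' ∩ T'' = {z} ∧
    ν Set.univ / 3 ≤ ν T' ∧ ν Set.univ / 3 ≤ ν T''

/-- The observable central radius `ObsCRad_Y(X; -κ)`, the supremum of the central radii of
push-forwards under `1`-Lipschitz maps (taken at their centers of mass). -/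
noncomputable def obsCRad (Y : Type*) [MetricSpace Y] [MeasurableSpace Y]
    {X : Type*} [MetricSpace X] [MeasurableSpace X] (μ : Measure X) (κ : ℝ≥0∞) : ℝ≥0∞ :=
  ⨆ (f : X → Y) (_ : LipschitzWith 1 f) (c : Y) (_ : IsCenterOfMass (Measure.map f μ) c),
    cRad (Measure.map f μ) c (μ Set.univ - κ)

universe u v

section TreeVariation

variable {X : Type*} [MeasurableSpace X] {μ : Measure X} {p : ℝ}

/-- The double integral defining `V_p` of a push-forward, computed on the source. -/
noncomputable def variationIntegral {Y : Type*} [PseudoEMetricSpace Y] (μ : Measure X) (p : ℝ)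
    (f : X → Y) : ℝ≥0∞ :=
  ∫⁻ x, ∫⁻ y, edist (f x) (f y) ^ p ∂μ ∂μ

theorem varP_map_le {Y : Type*} [PseudoEMetricSpace Y] [MeasurableSpace Y] (hp : 0 < p)
    (f : X → Y) : varP (μ.map f) p ≤ variationIntegral μ p f ^ (1 / p) := by
  unfold varP variationIntegral
  refine ENNReal.rpow_le_rpow ?_ (by positivity)
  refine (lintegral_map_le _ _).trans (lintegral_mono fun x => ?_)
  exact lintegral_map_le (fun y => edist (f x) y ^ p) f

theorem varP_map_eq {Y : Type*} [PseudoEMetricSpace Y] [SecondCountableTopology Y]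
    [MeasurableSpace Y] [OpensMeasurableSpace Y] [SFinite μ] {f : X → Y} (hf : Measurable f) :
    varP (μ.map f) p = variationIntegral μ p f ^ (1 / p) := by
  unfold varP variationIntegral
  rw [lintegral_map _ hf]
  · congr 2 with x
    exact lintegral_map (by fun_prop) hf
  · exact Measurable.lintegral_prod_right' (f := fun q : Y × Y => edist q.1 q.2 ^ p) (by fun_prop)

theorem variationIntegral_le_obsVar_rpow {X : Type*} [MetricSpace X] [MeasurableSpace X]
    [BorelSpace X] {μ : Measure X} [SFinite μ] (hp : 0 < p) {h : X → ℝ} (hh : LipschitzWith 1 h) :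
    variationIntegral μ p h ≤ obsVar ℝ μ p ^ p := by
  rw [← ENNReal.rpow_inv_le_iff hp, ← one_div, ← varP_map_eq hh.continuous.measurable]
  exact le_iSup₂_of_le h hh le_rfl

/-- If every `x` is at `h`-distance at least `φ x` from a set of mass at least `c`, then the
variation of `h` dominates `c ∫ φ ^ p`. -/
theorem mul_lintegral_rpow_le_variationIntegral {Y : Type*} [PseudoEMetricSpace Y] (hp : 0 ≤ p)
    {h : X → Y} {φ : X → ℝ≥0∞} (hφ : Measurable φ) {c : ℝ≥0∞}
    (H : ∀ x, ∃ Q, MeasurableSet Q ∧ c ≤ μ Q ∧ ∀ y ∈ Q, φ x ≤ edist (h x) (h y)) :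
    c * ∫⁻ x, φ x ^ p ∂μ ≤ variationIntegral μ p h := by
  rw [← lintegral_const_mul _ (by fun_prop)]
  refine lintegral_mono fun x => ?_
  obtain ⟨Q, hQ, hc, hle⟩ := H x
  calc c * φ x ^ p ≤ μ Q * φ x ^ p := by gcongr
    _ = ∫⁻ _ in Q, φ x ^ p ∂μ := by rw [setLIntegral_const, mul_comm]
    _ ≤ ∫⁻ y in Q, edist (h x) (h y) ^ p ∂μ :=
        setLIntegral_mono' hQ fun y hy => ENNReal.rpow_le_rpow (hle y hy) hp
    _ ≤ _ := setLIntegral_le_lintegral _ _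

theorem add_rpow_le {a b : ℝ≥0∞} (hp : 1 ≤ p) : (a + b) ^ p ≤ 2 ^ (p - 1) * (a ^ p + b ^ p) :=
  ENNReal.rpow_add_le_mul_rpow_add_rpow a b hp

/-- A map staying `p`-close to a point has small variation. -/
theorem variationIntegral_le_of_edist_le {Y : Type*} [PseudoEMetricSpace Y]
    (hp : 1 ≤ p) {f : X → Y} {z : Y} {φ : X → ℝ≥0∞} (hφ : Measurable φ) {r : ℝ≥0∞}
    (H : ∀ x, edist (f x) z ≤ φ x + r) :
    variationIntegral μ p f ≤
      2 ^ p * 2 ^ (p - 1) * (μ Set.univ * ∫⁻ x, φ x ^ p ∂μ)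
        + 2 ^ p * 2 ^ (p - 1) * μ Set.univ * μ Set.univ * r ^ p := by
  have hp0 : 0 ≤ p := by linarith
  set ψ : X → ℝ≥0∞ := fun x => (φ x + r) ^ p
  have hψm : Measurable ψ := by fun_prop
  have h1 : ∫⁻ x, ψ x ∂μ ≤ 2 ^ (p - 1) * (∫⁻ x, φ x ^ p ∂μ + r ^ p * μ Set.univ) := by
    calc ∫⁻ x, ψ x ∂μ ≤ ∫⁻ x, 2 ^ (p - 1) * (φ x ^ p + r ^ p) ∂μ :=
          lintegral_mono fun x => add_rpow_le hp
      _ = _ := by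
          rw [lintegral_const_mul _ (by fun_prop), lintegral_add_right _ measurable_const,
            lintegral_const]
  have h2 : variationIntegral μ p f ≤ 2 ^ p * μ Set.univ * ∫⁻ x, ψ x ∂μ := by
    calc variationIntegral μ p f
        ≤ ∫⁻ x, ∫⁻ y, 2 ^ (p - 1) * (ψ x + ψ y) ∂μ ∂μ := by
          refine lintegral_mono fun x => lintegral_mono fun y => ?_
          refine (ENNReal.rpow_le_rpow ?_ hp0).trans (add_rpow_le hp)
          exact (edist_triangle_right _ _ z).trans (add_le_add (H x) (H y))
      _ = 2 ^ (p - 1) * (2 * (μ Set.univ * ∫⁻ x, ψ x ∂μ)) := by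
          have : ∀ x, ∫⁻ y, 2 ^ (p - 1) * (ψ x + ψ y) ∂μ
              = 2 ^ (p - 1) * (ψ x * μ Set.univ + ∫⁻ y, ψ y ∂μ) := fun x => by
            rw [lintegral_const_mul _ (by fun_prop), lintegral_add_left measurable_const,
              lintegral_const]
          simp_rw [this]
          rw [lintegral_const_mul _ (by fun_prop), lintegral_add_right _ measurable_const,
            lintegral_const, lintegral_mul_const _ hψm]
          ring
      _ = _ := by
          have : (2 : ℝ≥0∞) ^ p = 2 ^ (p - 1) * 2 := by
            simpa using ENNReal.rpow_add (x := 2) (p - 1) 1 (by simp) (by simp)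
          rw [this]; ring
  refine h2.trans ((mul_le_mul_right h1 _).trans_eq ?_)
  ring

/-- Moving a distance `r` from `z` towards `w` brings one closer by `r` to all points whose
Gromov product with `w` at `z` exceeds `r`. -/
theorem IsRTree.exists_dist_le_sub {T : Type*} [MetricSpace T] (hT : IsRTree T) {z w : T} {r : ℝ}
    (hr : 0 ≤ r) (hw : r ≤ dist z w) :
    ∃ z', (∀ y, dist z' y ≤ dist z y + r) ∧
      ∀ y, 2 * r < dist y z + dist w z - dist y w → dist z' y ≤ dist z y - r := by
  obtain ⟨-, hgeo, h4⟩ := hT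
  obtain ⟨γ, h0, h1, hγ⟩ := hgeo z w
  have hzr : dist (γ r) z = r := by
    rw [← h0, hγ r ⟨hr, hw⟩ 0 ⟨le_rfl, dist_nonneg⟩, sub_zero, abs_of_nonneg hr]
  have hwr : dist (γ r) w = dist z w - r := by
    have := hγ r ⟨hr, hw⟩ (dist z w) ⟨dist_nonneg, le_rfl⟩
    rw [h1] at this
    rw [this, abs_sub_comm, abs_of_nonneg (by linarith)]
  refine ⟨γ r, fun y => ?_, fun y hy => ?_⟩
  · linarith [dist_triangle (γ r) z y]
  · have := h4 (γ r) y z w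
    rw [hzr, hwr] at this
    rw [dist_comm w z, dist_comm y z] at hy
    rw [dist_comm y z] at this
    rcases le_max_iff.1 this with h | h <;> linarith

/-- The points whose Gromov product with `w` at `z` exceeds `r` are separated from the others
by the ball of radius `r` around `z`. -/
theorem IsRTree.dist_add_dist_sub_le {T : Type*} [MetricSpace T] (hT : IsRTree T) {z w a b : T}
    {r : ℝ} (ha : 2 * r < dist a z + dist w z - dist a w)
    (hb : ¬ 2 * r < dist b z + dist w z - dist b w) :
    dist a z + dist b z - 2 * r ≤ dist a b := by
  have := hT.2.2 b w a z
  rw [dist_comm b a, dist_comm w a] at this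
  rcases le_max_iff.1 this with h | h <;> linarith

/-- Approximate medians exist. -/
theorem IsRTree.exists_forall_measureReal_le {T : Type*} [MetricSpace T] [Nonempty T]
    (hT : IsRTree T) [IsFiniteMeasure μ] (hμ : μ ≠ 0) {f : X → T}
    (hf : ∀ w, Measurable fun x => dist w (f x)) (hint : ∀ z, Integrable (fun x => dist z (f x)) μ)
    {r : ℝ} (hr : 0 < r) :
    ∃ z, ∀ w, μ.real {x | 2 * r < dist (f x) z + dist w z - dist (f x) w}
      ≤ 2 / 3 * μ.real Set.univ := by
  have hm : 0 < μ.real Set.univ := by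
    rw [measureReal_def]
    exact ENNReal.toReal_pos (by simpa using hμ) (measure_ne_top _ _)
  set F : T → ℝ := fun z => ∫ x, dist z (f x) ∂μ with hF
  have hbdd : BddBelow (Set.range F) := ⟨0, by
    rintro _ ⟨z, rfl⟩; exact integral_nonneg fun x => dist_nonneg⟩
  obtain ⟨z, hz⟩ := exists_lt_of_ciInf_lt
    (show iInf F < iInf F + μ.real Set.univ * r / 3 by linarith [mul_pos hm hr])
  refine ⟨z, fun w => ?_⟩
  by_contra! hU
  set U := {x | 2 * r < dist (f x) z + dist w z - dist (f x) w} with hUdef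
  have hUm : MeasurableSet U := by
    simp only [hUdef, dist_comm (f _)]
    exact measurableSet_lt measurable_const (((hf z).add_const _).sub (hf w))
  have hne : U.Nonempty := by
    rw [Set.nonempty_iff_ne_empty]
    intro h
    rw [h, measureReal_empty] at hU
    linarith
  obtain ⟨a, ha⟩ := hne
  have hzw : r ≤ dist z w := by
    have h1 : 2 * r < dist (f a) z + dist w z - dist (f a) w := ha
    have h2 := dist_triangle (f a) w z
    rw [dist_comm w z] at h1 h2
    linarith
  obtain ⟨z', h1, h2⟩ := hT.exists_dist_le_sub hr.le hzw
  have hle : F z' ≤ F z + r * μ.real Set.univ - 2 * r * μ.real U := by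
    have hind : Integrable (U.indicator fun _ => 2 * r) μ := (integrable_const _).indicator hUm
    calc F z' ≤ ∫ x, (dist z (f x) + r - U.indicator (fun _ => 2 * r) x) ∂μ := by
          refine integral_mono (hint z') (((hint z).add (integrable_const r)).sub hind) fun x => ?_
          by_cases hx : x ∈ U
          · simp only [Set.indicator_of_mem hx]
            linarith [h2 (f x) hx]
          · simp only [Set.indicator_of_notMem hx]
            linarith [h1 (f x)]
      _ = _ := by
          rw [integral_sub (by exact (hint z).add (integrable_const r)) hind,
            integral_add (hint z) (integrable_const r), integral_indicator hUm]
          simp [hF, mul_comm]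
  have := ciInf_le hbdd z'
  nlinarith

/-- Gluing `dist · z` with opposite signs along a decomposition separated by the ball of
radius `r` around `z`. -/
theorem lipschitzWith_ite_neg {T : Type*} [MetricSpace T] {z : T} {r : ℝ} {A : Set T}
    [DecidablePred (· ∈ A)]
    (hA : ∀ a ∈ A, ∀ b ∉ A, dist a z + dist b z - 2 * r ≤ dist a b) :
    LipschitzWith 1 fun a => if a ∈ A then max (dist a z - r) 0 else -max (dist a z - r) 0 := by
  refine LipschitzWith.of_le_add fun a b => ?_
  have h1 := dist_triangle a b z
  have h2 := dist_triangle b a z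
  have h4 := dist_comm a b
  by_cases ha : a ∈ A <;> by_cases hb : b ∈ A <;> simp only [ha, hb, if_true, if_false]
  · rcases max_cases (dist a z - r) 0 with h | h <;> rcases max_cases (dist b z - r) 0 with h' | h'
      <;> linarith [dist_nonneg (x := a) (y := b)]
  · have h3 := hA a ha b hb
    rcases max_cases (dist a z - r) 0 with h | h <;> rcases max_cases (dist b z - r) 0 with h' | h'
      <;> linarith [dist_nonneg (x := a) (y := b)]
  · linarith [le_max_right (dist a z - r) 0, le_max_right (dist b z - r) 0,
      dist_nonneg (x := a) (y := b)]
  · rcases max_cases (dist a z - r) 0 with h | h <;> rcases max_cases (dist b z - r) 0 with h' | h'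
      <;> linarith [dist_nonneg (x := a) (y := b)]

theorem third_le_measure_compl [IsFiniteMeasure μ] {A : Set X} (hA : MeasurableSet A)
    (h : μ.real A ≤ 2 / 3 * μ.real Set.univ) : μ Set.univ / 3 ≤ μ Aᶜ := by
  have h1 := measureReal_compl hA (μ := μ)
  rw [← ENNReal.toReal_le_toReal (ENNReal.div_ne_top (measure_ne_top _ _) (by simp))
    (measure_ne_top _ _), ENNReal.toReal_div]
  simp only [← measureReal_def, ENNReal.toReal_ofNat]
  linarith

/-- At an approximate median `z`, the function `dist · z` can be signed so as to stay `1`-Lipschitz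
and to oscillate as much as it can. -/
theorem IsRTree.exists_lipschitzWith_le_edist {X : Type*} [MetricSpace X]
    [TopologicalSpace.SeparableSpace X] [Nonempty X] [MeasurableSpace X] [BorelSpace X]
    {μ : Measure X} [IsFiniteMeasure μ] {T : Type*} [MetricSpace T] (hT : IsRTree T) {f : X → T}
    (hf : LipschitzWith 1 f) {r : ℝ} {z : T}
    (hz : ∀ w, μ.real {x | 2 * r < dist (f x) z + dist w z - dist (f x) w}
      ≤ 2 / 3 * μ.real Set.univ) :
    ∃ h : X → ℝ, LipschitzWith 1 h ∧ ∀ x, ∃ Q, MeasurableSet Q ∧ μ Set.univ / 3 ≤ μ Q ∧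
      ∀ y ∈ Q, ENNReal.ofReal (dist (f x) z - r) ≤ edist (h x) (h y) := by
  classical
  set U : T → Set T := fun w => {a | 2 * r < dist a z + dist w z - dist a w}
  have hcont := hf.continuous
  have hUo : ∀ w, IsOpen (U w) := fun w =>
    isOpen_lt continuous_const (by fun_prop)
  have key : ∀ A : Set T, IsOpen A → (∀ a ∈ A, ∀ b ∉ A, dist a z + dist b z - 2 * r ≤ dist a b) →
      μ Set.univ / 3 ≤ μ (f ⁻¹' A) → μ.real (f ⁻¹' A) ≤ 2 / 3 * μ.real Set.univ →
      ∃ h : X → ℝ, LipschitzWith 1 h ∧ ∀ x, ∃ Q, MeasurableSet Q ∧ μ Set.univ / 3 ≤ μ Q ∧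
        ∀ y ∈ Q, ENNReal.ofReal (dist (f x) z - r) ≤ edist (h x) (h y) := by
    intro A hAo hA h1 h2
    have hAm : MeasurableSet (f ⁻¹' A) := (hAo.preimage hcont).measurableSet
    have hc := third_le_measure_compl hAm h2
    refine ⟨_, by simpa using (lipschitzWith_ite_neg hA).comp hf, fun x => ?_⟩
    by_cases hx : f x ∈ A
    · refine ⟨_, hAm.compl, hc, fun y hy => ?_⟩
      have hy : f y ∉ A := hy
      rw [edist_dist, Real.dist_eq]
      refine ENNReal.ofReal_le_ofReal ?_
      simp only [Function.comp_apply, hx, hy, if_true, if_false]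
      refine le_trans ?_ (le_abs_self _)
      linarith [le_max_left (dist (f x) z - r) 0, le_max_right (dist (f y) z - r) 0]
    · refine ⟨_, hAm, h1, fun y hy => ?_⟩
      have hy : f y ∈ A := hy
      rw [edist_dist, Real.dist_eq]
      refine ENNReal.ofReal_le_ofReal ?_
      simp only [Function.comp_apply, hx, hy, if_true, if_false]
      refine le_trans ?_ (neg_le_abs _)
      linarith [le_max_left (dist (f x) z - r) 0, le_max_right (dist (f y) z - r) 0]
  have hsep : ∀ w, ∀ a ∈ U w, ∀ b ∉ U w, dist a z + dist b z - 2 * r ≤ dist a b :=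
    fun w a ha b hb => hT.dist_add_dist_sub_le ha hb
  by_cases hbig : ∃ w, μ Set.univ / 3 ≤ μ (f ⁻¹' U w)
  · obtain ⟨w, hw⟩ := hbig
    exact key (U w) (hUo w) (hsep w) hw (hz w)
  push Not at hbig
  set u : ℕ → T := fun k => f (TopologicalSpace.denseSeq X k)
  set A : ℕ → Set T := fun n => ⋃ k < n, U (u k) with hAdef
  have hAo : ∀ n, IsOpen (A n) := fun n => isOpen_biUnion fun k _ => hUo _
  by_cases hex : ∃ n, μ Set.univ / 3 ≤ μ (f ⁻¹' A n)
  · have hspec := Nat.find_spec hex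
    refine key (A (Nat.find hex)) (hAo _) ?_ hspec ?_
    · intro a ha b hb
      simp only [hAdef, Set.mem_iUnion, exists_prop, not_exists, not_and] at ha hb
      obtain ⟨k, hk, hak⟩ := ha
      exact hsep _ a hak b (hb k hk)
    · rcases hn : Nat.find hex with _ | k
      · have : A 0 = ∅ := by simp [hAdef]
        rw [this, Set.preimage_empty, measureReal_empty]
        positivity
      · have hk : μ (f ⁻¹' A k) < μ Set.univ / 3 := by
          have := Nat.find_min hex (m := k) (by omega)
          exact not_le.1 this
        have hsucc : A (k + 1) = A k ∪ U (u k) := Set.biUnion_lt_succ (fun k => U (u k)) k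
        have hle : μ (f ⁻¹' A (k + 1)) ≤ μ Set.univ / 3 + μ Set.univ / 3 := by
          rw [hsucc, Set.preimage_union]
          exact (measure_union_le _ _).trans (add_le_add hk.le (hbig _).le)
        have htop : μ Set.univ / 3 ≠ ⊤ := ENNReal.div_ne_top (measure_ne_top _ _) (by simp)
        have := ENNReal.toReal_mono (ENNReal.add_ne_top.2 ⟨htop, htop⟩) hle
        rw [ENNReal.toReal_add htop htop, ENNReal.toReal_div, ENNReal.toReal_ofNat] at this
        simp only [← measureReal_def] at this
        linarith
  · push Not at hex
    have hmono : Monotone fun n => f ⁻¹' A n := fun i j hij =>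
      Set.preimage_mono (Set.biUnion_subset_biUnion_left fun k (hk : k < i) => hk.trans_le hij)
    have hlim : μ (⋃ n, f ⁻¹' A n) ≤ μ Set.univ / 3 := by
      rw [hmono.measure_iUnion]
      exact iSup_le fun n => (hex n).le
    have hfar : {x | r < dist (f x) z} ⊆ ⋃ n, f ⁻¹' A n := by
      intro x hx
      have hopen : IsOpen {x' | 2 * r < dist (f x) z + dist (f x') z - dist (f x) (f x')} :=
        isOpen_lt continuous_const (by fun_prop)
      obtain ⟨k, hk⟩ := (TopologicalSpace.denseRange_denseSeq X).exists_mem_open hopen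
        ⟨x, by simp only [Set.mem_ofPred_eq, dist_self] at hx ⊢; linarith⟩
      simp only [Set.mem_iUnion, Set.mem_preimage, hAdef, exists_prop]
      exact ⟨k + 1, k, k.lt_succ_self, hk⟩
    have hVm : MeasurableSet {x | r < dist (f x) z} :=
      (isOpen_lt continuous_const (by fun_prop)).measurableSet
    have hV : μ.real {x | r < dist (f x) z} ≤ 2 / 3 * μ.real Set.univ := by
      have := ENNReal.toReal_mono (ENNReal.div_ne_top (measure_ne_top μ _) (by simp))
        ((measure_mono hfar).trans hlim)
      rw [ENNReal.toReal_div, ENNReal.toReal_ofNat] at this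
      simp only [← measureReal_def] at this
      linarith [measureReal_nonneg (μ := μ) (s := Set.univ)]
    refine ⟨fun x => max (dist (f x) z - r) 0, ?_, fun x =>
      ⟨_, hVm.compl, third_le_measure_compl hVm hV, fun y hy => ?_⟩⟩
    · have := (lipschitzWith_ite_neg (z := z) (r := r) (A := Set.univ) (by simp)).comp hf
      simpa [Function.comp_def] using this
    · have hy' : dist (f y) z - r ≤ 0 := by
        simp only [Set.mem_compl_iff, Set.mem_ofPred_eq, not_lt] at hy
        linarith
      beta_reduce
      rw [edist_dist, Real.dist_eq, max_eq_right hy', sub_zero]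
      exact ENNReal.ofReal_le_ofReal ((le_max_left _ _).trans (le_abs_self _))

/-- Finite variation of a real function forces integrability. -/
theorem integrable_of_variationIntegral_ne_top [IsFiniteMeasure μ] (hμ : μ ≠ 0) (hp : 1 ≤ p)
    {h : X → ℝ} (hm : Measurable h) (hfin : variationIntegral μ p h ≠ ⊤) : Integrable h μ := by
  have hmeas : Measurable fun x => ∫⁻ y, edist (h x) (h y) ^ p ∂μ :=
    Measurable.lintegral_prod_right' (f := fun q : X × X => edist (h q.1) (h q.2) ^ p)
      (by fun_prop)
  have : NeZero μ := ⟨hμ⟩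
  obtain ⟨x, hx⟩ := (ae_lt_top hmeas hfin).exists
  have hsub : Integrable (fun y => h x - h y) μ := by
    refine ⟨by fun_prop, ?_⟩
    rw [hasFiniteIntegral_iff_enorm]
    refine lt_of_le_of_lt (lintegral_mono (g := fun y => 1 + edist (h x) (h y) ^ p) fun y => ?_) ?_
    · beta_reduce
      rw [edist_eq_enorm_sub]
      rcases le_total ‖h x - h y‖ₑ 1 with h1 | h1
      · exact h1.trans le_self_add
      · calc ‖h x - h y‖ₑ = ‖h x - h y‖ₑ ^ (1 : ℝ) := (ENNReal.rpow_one _).symm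
          _ ≤ ‖h x - h y‖ₑ ^ p := ENNReal.rpow_le_rpow_of_exponent_le h1 hp
          _ ≤ _ := le_add_self
    · rw [lintegral_add_left measurable_const, lintegral_one]
      exact ENNReal.add_lt_top.2 ⟨measure_lt_top _ _, hx⟩
  exact ((integrable_const (h x)).sub hsub).congr (.of_forall fun y => sub_sub_cancel _ _)

theorem IsRTree.variationIntegral_le {X : Type*} [MetricSpace X]
    [TopologicalSpace.SeparableSpace X] [MeasurableSpace X] [BorelSpace X]
    {μ : Measure X} [IsFiniteMeasure μ] {T : Type*} [MetricSpace T] (hT : IsRTree T) (hp : 1 ≤ p)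
    {f : X → T} (hf : LipschitzWith 1 f) (hfin : obsVar ℝ μ p ≠ ⊤) :
    variationIntegral μ p f ≤ 2 ^ p * 2 ^ (p - 1) * (3 * obsVar ℝ μ p ^ p) := by
  have hp0 : 0 < p := by linarith
  rcases eq_or_ne μ 0 with rfl | hμ
  · simp [variationIntegral]
  have : Nonempty X := by
    by_contra hX
    rw [not_nonempty_iff] at hX
    exact hμ (Measure.eq_zero_of_isEmpty μ)
  have : Nonempty T := ‹Nonempty X›.map f
  have hcont := hf.continuous
  have hdist : ∀ w, LipschitzWith 1 fun x => dist w (f x) := fun w => by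
    simpa [Function.comp_def] using (LipschitzWith.dist_right w).comp hf
  have hint : ∀ w, Integrable (fun x => dist w (f x)) μ := fun w =>
    integrable_of_variationIntegral_ne_top hμ hp (hdist w).continuous.measurable
      (ne_top_of_le_ne_top (ENNReal.rpow_ne_top_of_nonneg hp0.le hfin)
        (variationIntegral_le_obsVar_rpow hp0 (hdist w)))
  have hbound : ∀ r : ℝ, 0 < r → variationIntegral μ p f ≤
      2 ^ p * 2 ^ (p - 1) * (3 * obsVar ℝ μ p ^ p)
        + 2 ^ p * 2 ^ (p - 1) * μ Set.univ * μ Set.univ * ENNReal.ofReal r ^ p := by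
    intro r hr
    obtain ⟨z, hz⟩ := hT.exists_forall_measureReal_le hμ
      (fun w => (hdist w).continuous.measurable) hint hr
    obtain ⟨h, hh, hQ⟩ := hT.exists_lipschitzWith_le_edist hf hz
    have hφ : Measurable fun x => ENNReal.ofReal (dist (f x) z - r) :=
      (show Continuous fun x => dist (f x) z - r by fun_prop).measurable.ennreal_ofReal
    have h1 := (mul_lintegral_rpow_le_variationIntegral hp0.le hφ hQ).trans
      (variationIntegral_le_obsVar_rpow hp0 hh)
    refine (variationIntegral_le_of_edist_le hp hφ (r := ENNReal.ofReal r) (z := z)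
      fun x => ?_).trans ?_
    · rw [edist_dist]
      simpa using ENNReal.ofReal_add_le (p := dist (f x) z - r) (q := r)
    · refine add_le_add_left (mul_le_mul_right ?_ _) _
      calc μ Set.univ * ∫⁻ x, ENNReal.ofReal (dist (f x) z - r) ^ p ∂μ
          = 3 * (μ Set.univ / 3 * ∫⁻ x, ENNReal.ofReal (dist (f x) z - r) ^ p ∂μ) := by
            rw [← mul_assoc, ENNReal.mul_div_cancel (by simp) (by simp)]
        _ ≤ _ := by gcongr
  have hconst : 2 ^ p * 2 ^ (p - 1) * μ Set.univ * μ Set.univ ≠ ⊤ := by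
    have : ∀ q : ℝ, 0 ≤ q → (2 : ℝ≥0∞) ^ q ≠ ⊤ := fun q hq =>
      ENNReal.rpow_ne_top_of_nonneg hq (by simp)
    exact ENNReal.mul_ne_top (ENNReal.mul_ne_top (ENNReal.mul_ne_top (this p hp0.le)
      (this (p - 1) (by linarith))) (measure_ne_top _ _)) (measure_ne_top _ _)
  have hlim : Filter.Tendsto (fun r : ℝ => 2 ^ p * 2 ^ (p - 1) * (3 * obsVar ℝ μ p ^ p)
        + 2 ^ p * 2 ^ (p - 1) * μ Set.univ * μ Set.univ * ENNReal.ofReal r ^ p)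
      (nhdsWithin 0 (Set.Ioi 0)) (nhds (2 ^ p * 2 ^ (p - 1) * (3 * obsVar ℝ μ p ^ p))) := by
    have hr : Filter.Tendsto (fun r : ℝ => ENNReal.ofReal r ^ p) (nhdsWithin 0 (Set.Ioi 0))
        (nhds 0) := by
      have : Continuous fun r : ℝ => ENNReal.ofReal r ^ p :=
        ENNReal.continuous_rpow_const.comp ENNReal.continuous_ofReal
      simpa [hp0] using (this.tendsto 0).mono_left nhdsWithin_le_nhds
    simpa using tendsto_const_nhds.add (ENNReal.Tendsto.const_mul hr (Or.inr hconst))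
  exact ge_of_tendsto hlim (Filter.eventually_of_mem self_mem_nhdsWithin hbound)

theorem IsRTree.obsVar_le {X : Type*} [MetricSpace X]
    [TopologicalSpace.SeparableSpace X] [MeasurableSpace X] [BorelSpace X]
    {μ : Measure X} [IsFiniteMeasure μ] {T : Type*} [MetricSpace T] [MeasurableSpace T]
    (hT : IsRTree T) (hp : 1 ≤ p) :
    obsVar T μ p ≤ 4 * 2 ^ (1 / p) * obsVar ℝ μ p := by
  have hp0 : 0 < p := by linarith
  rcases eq_or_ne (obsVar ℝ μ p) ⊤ with hfin | hfin
  · rw [hfin, ENNReal.mul_top]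
    · exact le_top
    · simp
  refine iSup₂_le fun f hf => (varP_map_le hp0 f).trans ?_
  rw [one_div, ENNReal.rpow_inv_le_iff hp0, ENNReal.mul_rpow_of_nonneg _ _ hp0.le,
    ENNReal.mul_rpow_of_nonneg _ _ hp0.le, ENNReal.rpow_inv_rpow hp0.ne']
  have h2 : (2 : ℝ≥0∞) ^ p = 2 ^ (p - 1) * 2 := by
    simpa using ENNReal.rpow_add (x := 2) (p - 1) 1 (by simp) (by simp)
  have h4 : (4 : ℝ≥0∞) ^ p = 2 ^ p * 2 ^ p := by
    rw [← ENNReal.mul_rpow_of_nonneg _ _ hp0.le]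
    norm_num
  calc variationIntegral μ p f ≤ 2 ^ p * 2 ^ (p - 1) * (3 * obsVar ℝ μ p ^ p) :=
        hT.variationIntegral_le hp hf hfin
    _ ≤ 2 ^ p * 2 ^ (p - 1) * (4 * obsVar ℝ μ p ^ p) := by
        gcongr
        norm_num
    _ = 2 ^ p * (2 ^ (p - 1) * 2) * 2 * obsVar ℝ μ p ^ p := by ring
    _ = _ := by rw [h4, ← h2]

theorem four_mul_le_two_mul {t : ℝ≥0∞} (ht : 1 ≤ t) : 4 * t ≤ 2 * (t * (1 + 2 * t) + 1) :=
  calc 4 * t = 2 * (t * (2 * 1)) := by ring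
    _ ≤ 2 * (t * (2 * t)) := by gcongr
    _ ≤ 2 * (t * (1 + 2 * t) + 1) := by
        gcongr
        exact (mul_le_mul_right le_add_self t).trans le_self_add

theorem isRTree_real : IsRTree ℝ := by
  refine ⟨inferInstance, fun z w => ?_, fun x y z w => ?_⟩
  · rcases le_total z w with h | h
    · refine ⟨fun t => z + t, by simp, ?_, fun s _ t _ => ?_⟩
      · simp [Real.dist_eq, abs_sub_comm z w, abs_of_nonneg (sub_nonneg.2 h)]
      · simp [Real.dist_eq]
    · refine ⟨fun t => z - t, by simp, ?_, fun s _ t _ => ?_⟩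
      · simp [Real.dist_eq, abs_of_nonneg (sub_nonneg.2 h)]
      · rw [Real.dist_eq, abs_sub_comm s t]
        congr 1
        ring
  · simp only [Real.dist_eq, le_max_iff]
    grind

theorem isRTree_ulift {T : Type*} [MetricSpace T] (hT : IsRTree T) : IsRTree (ULift T) := by
  obtain ⟨hc, hg, h4⟩ := hT
  refine ⟨inferInstance, fun z w => ?_, fun x y z w => h4 x.down y.down z.down w.down⟩
  obtain ⟨γ, h0, h1, hγ⟩ := hg z.down w.down
  exact ⟨fun t => ULift.up (γ t), ULift.ext _ _ h0, ULift.ext _ _ h1, hγ⟩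

theorem obsVar_le_obsVar_ulift {X : Type*} [MetricSpace X] [MeasurableSpace X] [BorelSpace X]
    {μ : Measure X} [SFinite μ] [MeasurableSpace (ULift.{v} ℝ)] [BorelSpace (ULift.{v} ℝ)] :
    obsVar ℝ μ p ≤ obsVar (ULift.{v} ℝ) μ p := by
  refine iSup₂_le fun f hf => ?_
  have hf' : LipschitzWith 1 fun x => (ULift.up (f x) : ULift.{v} ℝ) := hf
  refine le_iSup₂_of_le _ hf' ?_
  have : SecondCountableTopology (ULift.{v} ℝ) :=
    Homeomorph.ulift.{v, 0}.secondCountableTopology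
  rw [varP_map_eq hf.continuous.measurable, varP_map_eq hf'.continuous.measurable]
  rfl

end TreeVariation

/-- For any mm-space `X`, `ℝ`-tree `T` and `p ≥ 1`,
`ObsL^pVar_T(X) ≤ 2 (2^{1/p}(1 + 2·2^{1/p}) + 1) ObsL^pVar_ℝ(X)`; consequently, for a sequence
of mm-spaces, `ObsL^pVar_ℝ(X_n) → 0` iff `sup { ObsL^pVar_T(X_n) : T an ℝ-tree } → 0`. -/
theorem obsVar_tree_le_and_tendsto_iff (p : ℝ) (hp : 1 ≤ p) :
    (∀ (X : Type u) [MetricSpace X] [CompleteSpace X] [TopologicalSpace.SeparableSpace X]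
        [MeasurableSpace X] [BorelSpace X] (μ : Measure X) [IsFiniteMeasure μ]
        (T : Type v) [MetricSpace T] [MeasurableSpace T] [BorelSpace T], IsRTree T →
        obsVar T μ p
          ≤ 2 * ((2 : ℝ≥0∞) ^ (1 / p) * (1 + 2 * (2 : ℝ≥0∞) ^ (1 / p)) + 1) * obsVar ℝ μ p)
      ∧
    (∀ (X : ℕ → Type u) [∀ n, MetricSpace (X n)] [∀ n, CompleteSpace (X n)]
        [∀ n, TopologicalSpace.SeparableSpace (X n)]
        [∀ n, MeasurableSpace (X n)] [∀ n, BorelSpace (X n)]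
        (μ : ∀ n, Measure (X n)) [∀ n, IsFiniteMeasure (μ n)],
        Filter.Tendsto (fun n => obsVar ℝ (μ n) p) Filter.atTop (nhds 0)
          ↔
        (∀ ε : ℝ≥0∞, 0 < ε → ∃ N : ℕ, ∀ n ≥ N,
          ∀ (T : Type v) [MetricSpace T] [MeasurableSpace T] [BorelSpace T],
            IsRTree T → obsVar T (μ n) p ≤ ε)) := by
  have hp0 : 0 < p := by linarith
  refine ⟨?_, ?_⟩
  · intro X _ _ _ _ _ μ _ T _ _ _ hT
    refine (hT.obsVar_le hp).trans (mul_le_mul_left (four_mul_le_two_mul ?_) _)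
    exact ENNReal.one_le_rpow (by norm_num) (by positivity)
  · intro X _ _ _ _ _ μ _
    rw [ENNReal.tendsto_atTop_zero]
    constructor
    · intro h ε hε
      have hC0 : (4 * 2 ^ (1 / p) : ℝ≥0∞) ≠ 0 := by simp
      have hC : (4 * 2 ^ (1 / p) : ℝ≥0∞) ≠ ⊤ :=
        ENNReal.mul_ne_top (by simp) (ENNReal.rpow_ne_top_of_nonneg (by positivity) (by simp))
      obtain ⟨N, hN⟩ := h (ε / (4 * 2 ^ (1 / p))) (ENNReal.div_pos hε.ne' hC)
      refine ⟨N, fun n hn T _ _ _ hT => (hT.obsVar_le hp).trans ?_⟩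
      rw [mul_comm]
      exact (ENNReal.le_div_iff_mul_le (.inl hC0) (.inl hC)).1 (hN n hn)
    · intro h ε hε
      obtain ⟨N, hN⟩ := h ε hε
      let _ : MeasurableSpace (ULift.{v} ℝ) := borel _
      have : BorelSpace (ULift.{v} ℝ) := ⟨rfl⟩
      exact ⟨N, fun n hn =>
        obsVar_le_obsVar_ulift.trans (hN n hn (ULift.{v} ℝ) (isRTree_ulift isRTree_real))⟩
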